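/- Every connected graph G has a stable tree-decomposition whose width equals the tree-width of G. -/

import Mathlib

open SimpleGraph

universe u

/-- `x` and `y` are joined by a walk in `G` all of whose vertices lie in `S`. -/
def ConnIn {V : Type u} (G : SimpleGraph V) (S : Set V) (x y : V) : Prop :=
  ∃ p : G.Walk x y, ∀ v ∈ p.support, v ∈ S

/-- `S` is a (nonempty) connected vertex set of `G`, i.e. `G[S]` is connected. -/
def IsConnSet {V : Type u} (G : SimpleGraph V) (S : Set V) : Prop :=
  S.Nonempty ∧ ∀ x ∈ S, ∀ y ∈ S, ConnIn G S x y

/-- A tree-decomposition of `G` over the tree `T`. -/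
structure TreeDecomp {V ι : Type u} (G : SimpleGraph V) (T : SimpleGraph ι) where
  isTree : T.IsTree
  bag : ι → Set V
  exists_bag : ∀ v : V, ∃ t, v ∈ bag t
  exists_bag_adj : ∀ ⦃u v : V⦄, G.Adj u v → ∃ t, u ∈ bag t ∧ v ∈ bag t
  bag_sep : ∀ ⦃t₁ t₃ : ι⦄ (p : T.Walk t₁ t₃), p.IsPath → ∀ t₂ ∈ p.support,
      bag t₁ ∩ bag t₃ ⊆ bag t₂

/-- The union of the bags `B u` over `u ∈ A`. -/
def unionBags {V ι : Type u} (B : ι → Set V) (A : Set ι) : Set V := ⋃ u ∈ A, B u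

/-- `s` is a descendant of `t` in the tree `T` rooted at `r`:
`t` lies on the (unique) `r`–`s` path. -/
def Desc {ι : Type u} (T : SimpleGraph ι) (r t s : ι) : Prop :=
  ∃ p : T.Walk r s, p.IsPath ∧ t ∈ p.support

/-- The set of descendants of `t` (the subtree `T_t`). -/
def descSet {ι : Type u} (T : SimpleGraph ι) (r t : ι) : Set ι := {s | Desc T r t s}

/-- `s` is a child of `t` in the tree `T` rooted at `r`. -/
def IsChild {ι : Type u} (T : SimpleGraph ι) (r t s : ι) : Prop :=
  T.Adj t s ∧ Desc T r t s

/-- The vertex set of the component of `t₁` in `T` minus the edge `t₁t₂`. -/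
def Side {ι : Type u} (T : SimpleGraph ι) (t₁ t₂ : ι) : Set ι :=
  {u | ∃ p : T.Walk u t₁, p.IsPath ∧ t₂ ∉ p.support}

/-- The family of bags `B` is stable: for every tree edge `t₁t₂`, both sides
induce connected subgraphs of `G`. -/
def StableBags {V ι : Type u} (G : SimpleGraph V) (T : SimpleGraph ι) (B : ι → Set V) : Prop :=
  ∀ ⦃t₁ t₂ : ι⦄, T.Adj t₁ t₂ → IsConnSet G (unionBags B (Side T t₁ t₂))

def TreeDecomp.Stable {V ι : Type u} {G : SimpleGraph V} {T : SimpleGraph ι}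
    (td : TreeDecomp G T) : Prop :=
  StableBags G T td.bag

/-- `P` is a `t`-admissible path (w.r.t. the root `r` and bags `B`): a shortest
path lying in `V_{T_t}` joining two distinct components of `G[B t]`. -/
structure IsAdmissible {V ι : Type u} (G : SimpleGraph V) (T : SimpleGraph ι)
    (B : ι → Set V) (r t : ι) {x y : V} (P : G.Walk x y) : Prop where
  isPath : P.IsPath
  support_sub : ∀ v ∈ P.support, v ∈ unionBags B (descSet T r t)
  fst_mem : x ∈ B t
  snd_mem : y ∈ B t
  not_conn : ¬ ConnIn G (B t) x y
  minimal : ∀ ⦃x' y' : V⦄ (Q : G.Walk x' y'), Q.IsPath →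
      (∀ v ∈ Q.support, v ∈ unionBags B (descSet T r t)) →
      x' ∈ B t → y' ∈ B t → ¬ ConnIn G (B t) x' y' → P.length ≤ Q.length

/-- The updated bags obtained by adding the path `P` as in `(*)`:
`W_u = V_u ∪ (V(P) ∩ V_{T_u})` for descendants `u` of `t`, and `W_u = V_u` otherwise. -/
def updatedBag {V ι : Type u} (T : SimpleGraph ι) (B : ι → Set V) (r t : ι)
    {G : SimpleGraph V} {x y : V} (P : G.Walk x y) (u : ι) : Set V :=
  B u ∪ {v | Desc T r t u ∧ v ∈ P.support ∧ v ∈ unionBags B (descSet T r u)}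

/-- The tree-width of `G`: the least `k` such that `G` has a tree-decomposition
all of whose bags have at most `k + 1` vertices. -/
noncomputable def treewidth {V : Type u} (G : SimpleGraph V) : ℕ :=
  sInf {k | ∃ (ι : Type u) (T : SimpleGraph ι) (td : TreeDecomp G T),
    ∀ t, (td.bag t).ncard ≤ k + 1}

/-- A tree-decomposition is connected if every bag is a connected vertex set. -/
def TreeDecomp.IsConn {V ι : Type u} {G : SimpleGraph V} {T : SimpleGraph ι}
    (td : TreeDecomp G T) : Prop :=
  ∀ t, IsConnSet G (td.bag t)

/-- The connected tree-width of `G`. -/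
noncomputable def ctw {V : Type u} (G : SimpleGraph V) : ℕ :=
  sInf {k | ∃ (ι : Type u) (T : SimpleGraph ι) (td : TreeDecomp G T),
    td.IsConn ∧ ∀ t, (td.bag t).ncard ≤ k + 1}

/-- The weak connected tree-width of `G`: the least `k` such that `G` has a
tree-decomposition each of whose bags is contained in a connected set of at
most `k + 1` vertices. -/
noncomputable def wctw {V : Type u} (G : SimpleGraph V) : ℕ :=
  sInf {k | ∃ (ι : Type u) (T : SimpleGraph ι) (td : TreeDecomp G T),
    ∀ t, ∃ X, td.bag t ⊆ X ∧ IsConnSet G X ∧ X.ncard ≤ k + 1}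

/-- The characteristic vector over GF(2) of the edge set of a walk. -/
noncomputable def walkChar {V : Type u} {G : SimpleGraph V} {x y : V}
    (p : G.Walk x y) : Sym2 V → ZMod 2 :=
  fun e => by classical exact if e ∈ p.edges then 1 else 0

/-- The characteristic vectors of the cycles of `G` of length at most `ℓ`. -/
def cycleChars {V : Type u} (G : SimpleGraph V) (ℓ : ℕ) : Set (Sym2 V → ZMod 2) :=
  {f | ∃ (v : V) (p : G.Walk v v), p.IsCycle ∧ p.length ≤ ℓ ∧ f = walkChar p}

/-- The cycles of length at most `ℓ` generate the cycle space of `G` over GF(2). -/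
def GeneratesLE {V : Type u} (G : SimpleGraph V) (ℓ : ℕ) : Prop :=
  ∀ ⦃v : V⦄ (p : G.Walk v v), p.IsCycle →
    walkChar p ∈ Submodule.span (ZMod 2) (cycleChars G ℓ)

/-- `ℓ(G)`: the least `ℓ` such that the cycles of length at most `ℓ`
generate the cycle space of `G`. -/
noncomputable def ellGraph {V : Type u} (G : SimpleGraph V) : ℕ :=
  sInf {ℓ | GeneratesLE G ℓ}

/-- `Γ` is a set of cycles of `G` generating its cycle space over GF(2). -/
def GeneratesSet {V : Type u} (G : SimpleGraph V) (Γ : Set (Σ v : V, G.Walk v v)) : Prop :=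
  (∀ c ∈ Γ, c.2.IsCycle) ∧
  ∀ ⦃v : V⦄ (p : G.Walk v v), p.IsCycle →
    walkChar p ∈ Submodule.span (ZMod 2) {f | ∃ c ∈ Γ, f = walkChar c.2}

/-- A bramble: a collection of connected vertex sets, any two of which have
connected union. -/
def IsBramble {V : Type u} (G : SimpleGraph V) (B : Set (Set V)) : Prop :=
  (∀ S ∈ B, IsConnSet G S) ∧ ∀ S ∈ B, ∀ S' ∈ B, IsConnSet G (S ∪ S')

/-- `X` is a connected cover of the bramble `B`. -/
def IsConnCover {V : Type u} (G : SimpleGraph V) (B : Set (Set V)) (X : Set V) : Prop :=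
  IsConnSet G X ∧ ∀ S ∈ B, (X ∩ S).Nonempty

/-- The connected order of a bramble: the least size of a connected cover. -/
noncomputable def connOrder {V : Type u} (G : SimpleGraph V) (B : Set (Set V)) : ℕ :=
  sInf {n | ∃ X, IsConnCover G B X ∧ X.ncard = n}

/-- The maximum connected order of a bramble of `G`. -/
noncomputable def cbn {V : Type u} (G : SimpleGraph V) : ℕ :=
  sSup {n | ∃ B, IsBramble G B ∧ connOrder G B = n}

/-- A geodesic cycle: a cycle containing a shortest `G`-path between any two
of its vertices. -/
def IsGeodesicCycle {V : Type u} (G : SimpleGraph V) {v : V} (p : G.Walk v v) : Prop :=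
  p.IsCycle ∧ ∀ x ∈ p.support, ∀ y ∈ p.support,
    ∃ q : G.Walk x y, q.length = G.dist x y ∧ ∀ e ∈ q.edges, e ∈ p.edges

/-- The graph obtained from `K_n` by subdividing every edge exactly `k` times:
the edge between `i < j` is replaced by the path
`i, ((i,j),0), ((i,j),1), …, ((i,j),k-1), j`. -/
def subK (n k : ℕ) : SimpleGraph (Fin n ⊕ ({p : Fin n × Fin n // p.1 < p.2} × Fin k)) :=
  SimpleGraph.fromRel fun u v =>
    match u, v with
    | Sum.inl i, Sum.inl j => i < j ∧ k = 0
    | Sum.inl i, Sum.inr (e, c) =>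
        (e.val.1 = i ∧ (c : ℕ) = 0) ∨ (e.val.2 = i ∧ (c : ℕ) = k - 1)
    | Sum.inr (e, c), Sum.inr (e', c') => e = e' ∧ (c' : ℕ) = (c : ℕ) + 1
    | _, _ => False

section

variable {V ι : Type u}

theorem ConnIn.refl {G : SimpleGraph V} {S : Set V} {x : V} (hx : x ∈ S) : ConnIn G S x x :=
  ⟨Walk.nil, by simpa using hx⟩

theorem ConnIn.symm {G : SimpleGraph V} {S : Set V} {x y : V} (h : ConnIn G S x y) :
    ConnIn G S y x := by
  obtain ⟨p, hp⟩ := h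
  exact ⟨p.reverse, by simpa using hp⟩

theorem ConnIn.trans {G : SimpleGraph V} {S : Set V} {x y z : V} (h : ConnIn G S x y)
    (h' : ConnIn G S y z) : ConnIn G S x z := by
  obtain ⟨p, hp⟩ := h
  obtain ⟨q, hq⟩ := h'
  refine ⟨p.append q, fun v hv => ?_⟩
  rw [Walk.mem_support_append_iff] at hv
  exact hv.elim (hp v) (hq v)

theorem ConnIn.left_mem {G : SimpleGraph V} {S : Set V} {x y : V} (h : ConnIn G S x y) :
    x ∈ S := by
  obtain ⟨p, hp⟩ := h
  exact hp _ p.start_mem_support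

theorem ConnIn.right_mem {G : SimpleGraph V} {S : Set V} {x y : V} (h : ConnIn G S x y) :
    y ∈ S := h.symm.left_mem

theorem ConnIn.mono {G : SimpleGraph V} {S S' : Set V} {x y : V} (hS : S ⊆ S')
    (h : ConnIn G S x y) : ConnIn G S' x y := by
  obtain ⟨p, hp⟩ := h
  exact ⟨p, fun v hv => hS (hp v hv)⟩

theorem SimpleGraph.Adj.connIn {G : SimpleGraph V} {S : Set V} {x y : V} (h : G.Adj x y)
    (hx : x ∈ S) (hy : y ∈ S) : ConnIn G S x y :=
  ⟨h.toWalk, by simp [hx, hy]⟩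

/-- Induction along the vertices joined to `x` inside `S`. -/
theorem ConnIn.induction {G : SimpleGraph V} {S : Set V} {x y : V} {P : V → Prop}
    (h : ConnIn G S x y) (hx : P x)
    (step : ∀ a b, ConnIn G S x a → P a → G.Adj a b → b ∈ S → P b) : P y := by
  obtain ⟨p, hp⟩ := h
  have key : ∀ {a y : V} (p : G.Walk a y), (∀ v ∈ p.support, v ∈ S) → ConnIn G S x a → P a →
      P y := by
    intro a y p
    induction p with
    | nil => intro _ _ h; exact h
    | @cons a b c hab q ih =>
      intro hq hxa ha
      have hbS : b ∈ S := hq b (by simp)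
      have haS : a ∈ S := hq a (by simp)
      exact ih (fun v hv => hq v (by simp [hv])) (hxa.trans (hab.connIn haS hbS))
        (step a b hxa ha hab hbS)
  exact key p hp (ConnIn.refl (hp _ p.start_mem_support)) hx

theorem ConnIn.exists_exit {G : SimpleGraph V} {U K : Set V} {x z : V} (h : ConnIn G U x z)
    (hx : x ∈ K) (hz : z ∉ K) :
    ∃ a b, a ∈ K ∧ b ∉ K ∧ b ∈ U ∧ G.Adj a b ∧ ConnIn G (K ∩ U) x a := by
  by_contra! hcon
  have : ConnIn G (K ∩ U) x z := by
    refine h.induction (P := fun z => ConnIn G (K ∩ U) x z)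
      (ConnIn.refl ⟨hx, h.left_mem⟩) fun a b _ hxa hab hb => ?_
    by_cases hbK : b ∈ K
    · exact hxa.trans (hab.connIn hxa.right_mem ⟨hbK, hb⟩)
    · exact absurd hxa (hcon a b hxa.right_mem.1 hbK hb hab)
  exact hz this.right_mem.1

theorem ConnIn.map {W : Type u} {G : SimpleGraph V} {H : SimpleGraph W} {S : Set V} {S' : Set W}
    (f : V → W) (hf : ∀ a b, a ∈ S → b ∈ S → G.Adj a b → ConnIn H S' (f a) (f b))
    (hS : ∀ a ∈ S, f a ∈ S') {x y : V} (h : ConnIn G S x y) : ConnIn H S' (f x) (f y) :=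
  h.induction (P := fun y => ConnIn H S' (f x) (f y)) (ConnIn.refl (hS _ h.left_mem))
    fun a b hxa ha hab hb => ha.trans (hf a b hxa.right_mem hb hab)

theorem SimpleGraph.Connected.connIn_univ {G : SimpleGraph V} (hG : G.Connected) (x y : V) :
    ConnIn G Set.univ x y :=
  ⟨(hG x y).some, fun _ _ => Set.mem_univ _⟩

theorem ConnIn.reachable {G : SimpleGraph V} {S : Set V} {x y : V} (h : ConnIn G S x y) :
    G.Reachable x y := ⟨h.choose⟩

theorem SimpleGraph.Connected.isConnSet_univ {G : SimpleGraph V} (hG : G.Connected) :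
    IsConnSet G Set.univ :=
  ⟨⟨hG.nonempty.some, trivial⟩, fun x _ y _ => hG.connIn_univ x y⟩

theorem isConnSet_component {G : SimpleGraph V} {U : Set V} {x : V} (hx : x ∈ U) :
    IsConnSet G {z | ConnIn G U x z} := by
  have key : ∀ z, ConnIn G U x z → ConnIn G {z | ConnIn G U x z} x z := fun z h =>
    h.induction (P := fun z => ConnIn G {z | ConnIn G U x z} x z)
      (ConnIn.refl (ConnIn.refl hx)) fun a b hxa ha hab hb =>
      ha.trans (hab.connIn hxa (hxa.trans (hab.connIn hxa.right_mem hb)))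
  exact ⟨⟨x, ConnIn.refl hx⟩, fun a ha b hb => (key a ha).symm.trans (key b hb)⟩

/-- If `D` is a connected part of `U` to which every vertex of `U` with a neighbour in `A \ U` is
attached, then `U` inherits connectedness from `A`. -/
theorem IsConnSet.of_attached {G : SimpleGraph V} {A U D : Set V} (hA : IsConnSet G A)
    (hUA : U ⊆ A) (hDU : D ⊆ U) (hD : IsConnSet G D)
    (hatt : ∀ s ∈ U, ∀ z ∈ A, z ∉ U → G.Adj s z → ∃ d ∈ D, G.Adj s d) : IsConnSet G U := by
  by_cases hAU : A ⊆ U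
  · rwa [hUA.antisymm hAU]
  obtain ⟨z, hz, hzU⟩ := Set.not_subset.1 hAU
  obtain ⟨d₀, hd₀⟩ := hD.1
  have key : ∀ x ∈ U, ConnIn G U x d₀ := by
    intro x hx
    obtain ⟨a, b, ha, hb, hbA, hab, hxa⟩ := (hA.2 x (hUA hx) z hz).exists_exit hx hzU
    obtain ⟨d, hd, had⟩ := hatt a ha b hbA hb hab
    exact ((hxa.mono Set.inter_subset_left).trans (had.connIn ha (hDU hd))).trans
      ((hD.2 d hd d₀ hd₀).mono hDU)
  exact ⟨⟨d₀, hDU hd₀⟩, fun x hx y hy => (key x hx).trans (key y hy).symm⟩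

/-- `D` and `D'` are distinct full components of `H[A] - S`. -/
structure FullPair (H : SimpleGraph V) (A S D D' : Set V) : Prop where
  left_sub : D ⊆ A
  right_sub : D' ⊆ A
  sep_sub : S ⊆ A
  left_conn : IsConnSet H D
  right_conn : IsConnSet H D'
  disj : Disjoint D D'
  left_disj : Disjoint D S
  right_disj : Disjoint D' S
  left_full : ∀ s ∈ S, ∃ d ∈ D, H.Adj s d
  right_full : ∀ s ∈ S, ∃ d ∈ D', H.Adj s d
  left_closed : ∀ d ∈ D, ∀ z ∈ A, H.Adj d z → z ∈ D ∪ S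

theorem exists_fullPair_of_component {H : SimpleGraph V} {A Y : Set V} {x w : V}
    (hx : x ∈ A \ Y) (hw : w ∈ A) (hwC : ¬ ConnIn H (A \ Y) x w)
    (hwN : ∀ c, ConnIn H (A \ Y) x c → ¬ H.Adj w c) :
    ∃ S D D', S ⊆ Y ∧ FullPair H A S D D' := by
  set C : Set V := {z | ConnIn H (A \ Y) x z} with hC
  have hCconn : IsConnSet H C := isConnSet_component hx
  have hCA : C ⊆ A \ Y := fun z hz => hz.right_mem
  have hxC : x ∈ C := ConnIn.refl hx
  set R : Set V := {z | z ∈ A ∧ z ∉ C ∧ ∀ c ∈ C, ¬ H.Adj z c} with hR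
  have hwR : w ∈ R := ⟨hw, hwC, hwN⟩
  set D' : Set V := {z | ConnIn H R w z} with hD'
  have hD'R : D' ⊆ R := fun z hz => hz.right_mem
  set S : Set V := {s | s ∈ A ∧ s ∉ D' ∧ ∃ d ∈ D', H.Adj s d} with hS
  have hSN : ∀ s ∈ S, s ∉ C ∧ ∃ c ∈ C, H.Adj s c := by
    rintro s ⟨hsA, hsD, d, hd, hsd⟩
    have hsC : s ∉ C := fun h => (hD'R hd).2.2 s h hsd.symm
    refine ⟨hsC, ?_⟩
    by_contra! hcon
    exact hsD (ConnIn.trans hd (hsd.symm.connIn (hD'R hd) ⟨hsA, hsC, hcon⟩))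
  have hSY : S ⊆ Y := by
    intro s hs
    obtain ⟨hsC, c, hc, hsc⟩ := hSN s hs
    by_contra hsY
    exact hsC (ConnIn.trans hc (hsc.symm.connIn (hCA hc) ⟨hs.1, hsY⟩))
  have hCS : C ⊆ A \ S := fun c hc => ⟨(hCA hc).1, fun h => (hCA hc).2 (hSY h)⟩
  set D : Set V := {z | ConnIn H (A \ S) x z} with hD
  have hDA : D ⊆ A \ S := fun z hz => hz.right_mem
  have hCD : C ⊆ D := fun c hc => (hCconn.2 x hxC c hc).mono hCS
  refine ⟨S, D, D', hSY, ?_⟩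
  refine ⟨fun z hz => (hDA hz).1, fun z hz => (hD'R hz).1, fun s hs => hs.1,
    isConnSet_component (hCS hxC), isConnSet_component hwR, ?_, ?_, ?_, ?_, ?_, ?_⟩
  · rw [Set.disjoint_left]
    intro z hz hz'
    have : x ∈ D' := by
      refine (ConnIn.symm hz).induction (P := fun y => y ∈ D') hz' fun a b _ ha hab hb => ?_
      by_contra hbD
      exact hb.2 ⟨hb.1, hbD, a, ha, hab.symm⟩
    exact (hD'R this).2.1 hxC
  · exact Set.disjoint_left.2 fun z hz => (hDA hz).2
  · exact Set.disjoint_left.2 fun z hz hz' => hz'.2.1 hz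
  · intro s hs
    obtain ⟨-, c, hc, hsc⟩ := hSN s hs
    exact ⟨c, hCD hc, hsc⟩
  · exact fun s hs => hs.2.2
  · intro d hd z hz hdz
    by_cases hzS : z ∈ S
    · exact Or.inr hzS
    · exact Or.inl (ConnIn.trans hd (hdz.connIn (hDA hd) ⟨hz, hzS⟩))

/-- If the vertices outside the bag at `t` are connected and all of that bag is attached to them,
then the bag at `t` is contained in the neighbouring bag in their direction. -/
theorem TreeDecomp.bag_inter_subset_bag {H : SimpleGraph V} {T : SimpleGraph ι}
    (td : TreeDecomp H T) {A : Set V} {t t' s : ι} {x : V}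
    (hadj : T.Adj t t') (hs : ConnIn T {t}ᶜ s t') (hxs : x ∈ td.bag s) (hxA : x ∈ A \ td.bag t)
    (hconn : ∀ z ∈ A \ td.bag t, ConnIn H (A \ td.bag t) x z)
    (hatt : ∀ y ∈ A, y ∈ td.bag t → ∃ c ∈ A \ td.bag t, H.Adj y c) :
    td.bag t ∩ A ⊆ td.bag t' := by
  classical
  have share : ∀ z ∉ td.bag t, ∀ w w', z ∈ td.bag w → z ∈ td.bag w' → ConnIn T {t}ᶜ w t' →
      ConnIn T {t}ᶜ w' t' := by
    intro z hz w w' hw hw' hwt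
    obtain ⟨p, hp⟩ := td.isTree.connected.exists_isPath w' w
    refine ConnIn.trans ⟨p, fun v hv => ?_⟩ hwt
    rintro rfl
    exact hz (td.bag_sep p hp v hv ⟨hw', hw⟩)
  have key : ∀ z ∈ A \ td.bag t, ∀ w, z ∈ td.bag w → ConnIn T {t}ᶜ w t' := by
    intro z hz
    refine (hconn z hz).induction (P := fun z => ∀ w, z ∈ td.bag w → ConnIn T {t}ᶜ w t')
      (fun w hw => share x hxA.2 s w hxs hw hs) fun a b _ ha hab hb w hw => ?_
    obtain ⟨v, hva, hvb⟩ := td.exists_bag_adj hab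
    exact share b hb.2 v w hvb hw (ha v hva)
  rintro y ⟨hyt, hyA⟩
  obtain ⟨c, hc, hyc⟩ := hatt y hyA hyt
  obtain ⟨u, huy, huc⟩ := td.exists_bag_adj hyc
  obtain ⟨p, hp⟩ := (key c hc u huc).symm
  have hpath : (Walk.cons hadj p.bypass).IsPath := by
    rw [Walk.cons_isPath_iff]
    exact ⟨p.bypass_isPath, fun h => hp t (p.support_bypass_subset_support h) rfl⟩
  exact td.bag_sep _ hpath t' (by simp) ⟨hyt, huy⟩

theorem TreeDecomp.exists_fullPair [Finite V] {H : SimpleGraph V} {T : SimpleGraph ι}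
    (td : TreeDecomp H T) {A : Set V} (hA : ∀ t, ¬ A ⊆ td.bag t) :
    ∃ t S D D', S ⊆ td.bag t ∧ FullPair H A S D D' := by
  by_contra! hcon
  have hbad : ∀ t, ∀ x ∈ A \ td.bag t, ∀ w ∈ A, ConnIn H (A \ td.bag t) x w ∨
      ∃ c, ConnIn H (A \ td.bag t) x c ∧ H.Adj w c := by
    intro t x hx w hw
    by_contra! h
    obtain ⟨S, D, D', hS, hfull⟩ := exists_fullPair_of_component hx hw h.1 h.2
    exact hcon t S D D' hS hfull
  obtain ⟨t₀⟩ := td.isTree.connected.nonempty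
  have hbdd : ∀ t, (td.bag t ∩ A).ncard ≤ Nat.card V := fun t => Set.ncard_le_card _
  obtain ⟨m, ⟨t₁, ht₁⟩, hm⟩ : ∃ m, (∃ t, (td.bag t ∩ A).ncard = m) ∧
      ∀ t, (td.bag t ∩ A).ncard ≤ m := by
    classical
    have hex : ∃ t, (td.bag t ∩ A).ncard =
        Nat.findGreatest (fun m => ∃ t, (td.bag t ∩ A).ncard = m) (Nat.card V) :=
      Nat.findGreatest_spec (P := fun m => ∃ t, (td.bag t ∩ A).ncard = m) (hbdd t₀) ⟨t₀, rfl⟩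
    exact ⟨_, hex, fun t => Nat.le_findGreatest (hbdd t) ⟨t, rfl⟩⟩
  obtain ⟨n, ⟨t, s, htm, hts, hn⟩, hmin⟩ : ∃ n, (∃ t s, (td.bag t ∩ A).ncard = m ∧
      (∃ x ∈ A, x ∈ td.bag s ∧ x ∉ td.bag t) ∧ T.dist t s = n) ∧
      ∀ t s, (td.bag t ∩ A).ncard = m → (∃ x ∈ A, x ∈ td.bag s ∧ x ∉ td.bag t) →
        n ≤ T.dist t s := by
    classical
    have hex : ∃ n, ∃ t s, (td.bag t ∩ A).ncard = m ∧
        (∃ x ∈ A, x ∈ td.bag s ∧ x ∉ td.bag t) ∧ T.dist t s = n := by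
      obtain ⟨x, hxA, hx⟩ := Set.not_subset.1 (hA t₁)
      obtain ⟨s, hs⟩ := td.exists_bag x
      exact ⟨_, t₁, s, ht₁, ⟨x, hxA, hs, hx⟩, rfl⟩
    exact ⟨Nat.find hex, Nat.find_spec hex, fun t s h h' => Nat.find_min' hex ⟨t, s, h, h', rfl⟩⟩
  obtain ⟨x, hxA, hxs, hxt⟩ := hts
  obtain ⟨p, hp, hpl⟩ := td.isTree.connected.exists_path_of_dist t s
  cases p with
  | nil => exact hxt hxs
  | @cons _ t' _ hadj q =>
    rw [Walk.cons_isPath_iff] at hp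
    have hs : ConnIn T {t}ᶜ s t' := by
      refine ConnIn.symm ⟨q, fun v hv => ?_⟩
      rintro rfl
      exact hp.2 hv
    have hsub : td.bag t ∩ A ⊆ td.bag t' := by
      refine td.bag_inter_subset_bag hadj hs hxs ⟨hxA, hxt⟩ ?_ ?_
      · intro z hz
        rcases hbad t x ⟨hxA, hxt⟩ z hz.1 with h | ⟨c, hc, hzc⟩
        · exact h
        · exact hc.trans (hzc.symm.connIn hc.right_mem hz)
      · intro y hyA hyt
        rcases hbad t x ⟨hxA, hxt⟩ y hyA with h | ⟨c, hc, hyc⟩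
        · exact absurd hyt h.right_mem.2
        · exact ⟨c, hc.right_mem, hyc⟩
    have heq : td.bag t ∩ A = td.bag t' ∩ A :=
      Set.eq_of_subset_of_ncard_le (Set.subset_inter hsub Set.inter_subset_right)
        (by rw [htm]; exact hm t')
    have hxt' : x ∉ td.bag t' := fun h => hxt (heq.symm.subset ⟨h, hxA⟩).1
    have h1 := hmin t' s (heq ▸ htm) ⟨x, hxA, hxs, hxt'⟩
    have h2 : T.dist t' s ≤ q.length := SimpleGraph.dist_le q
    simp only [Walk.length_cons] at hpl
    omega

/-- A decomposition of `H[A]` over the connected graph `T` in which every edge of `T` is a bridge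
whose adhesion set has a full component on either side. -/
structure IsTight (H : SimpleGraph V) (A : Set V) (T : SimpleGraph ι) (B : ι → Set V) :
    Prop where
  connected : T.Connected
  bag_sub : ∀ t, B t ⊆ A
  clique_sub : ∀ Q ⊆ A, H.IsClique Q → ∃ t, Q ⊆ B t
  link : ∀ v t₁ t₂, v ∈ B t₁ → v ∈ B t₂ → ConnIn T {t | v ∈ B t} t₁ t₂
  full : ∀ t₁ t₂, T.Adj t₁ t₂ → ∃ X : Set ι, t₁ ∈ X ∧ t₂ ∉ X ∧
    (∀ u ∈ X, ∀ w ∉ X, T.Adj u w → u = t₁ ∧ w = t₂) ∧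
    ∃ D ⊆ A \ unionBags B Xᶜ, IsConnSet H D ∧
      ∀ v ∈ unionBags B X, v ∈ unionBags B Xᶜ → ∃ d ∈ D, H.Adj v d

theorem mem_unionBags {B : ι → Set V} {X : Set ι} {v : V} :
    v ∈ unionBags B X ↔ ∃ t ∈ X, v ∈ B t := by
  simp [unionBags]

theorem isTight_single (H : SimpleGraph V) (A : Set V) :
    IsTight H A (⊥ : SimpleGraph PUnit.{u + 1}) fun _ => A where
  connected := ⟨fun _ _ => Reachable.refl _⟩
  bag_sub _ := le_rfl
  clique_sub _ hQ _ := ⟨⟨⟩, hQ⟩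
  link _ _ _ h _ := ConnIn.refl h
  full _ _ h := h.elim

/-- `H` with all edges inside `S` added. -/
def addClique (H : SimpleGraph V) (S : Set V) : SimpleGraph V where
  Adj x y := H.Adj x y ∨ x ≠ y ∧ x ∈ S ∧ y ∈ S
  symm := ⟨by rintro x y (h | ⟨h, hx, hy⟩); exacts [Or.inl h.symm, Or.inr ⟨h.symm, hy, hx⟩]⟩
  loopless := ⟨by rintro x (h | ⟨h, -⟩); exacts [h.ne rfl, h rfl]⟩

theorem le_addClique (H : SimpleGraph V) (S : Set V) : H ≤ addClique H S := fun _ _ h => Or.inl h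

theorem IsConnSet.of_addClique {H : SimpleGraph V} {S D : Set V} (h : IsConnSet (addClique H S) D)
    (hS : Disjoint D S) : IsConnSet H D :=
  ⟨h.1, fun x hx y hy => (h.2 x hx y hy).map id (fun _ _ ha hb hab =>
    (hab.resolve_right fun h => Set.disjoint_left.1 hS ha h.2.1).connIn ha hb) fun _ h => h⟩

theorem IsConnSet.union_of_addClique {H : SimpleGraph V} {S D E : Set V}
    (h : IsConnSet (addClique H S) D) (hE : IsConnSet H E) (hDS : (D ∩ S).Nonempty)
    (hfull : ∀ s ∈ S, ∃ e ∈ E, H.Adj s e) : IsConnSet H (D ∪ E) := by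
  have hED : ∀ x ∈ E, ∀ y ∈ E, ConnIn H (D ∪ E) x y :=
    fun x hx y hy => (hE.2 x hx y hy).mono Set.subset_union_right
  have hDD : ∀ x ∈ D, ∀ y ∈ D, ConnIn H (D ∪ E) x y := by
    intro x hx y hy
    refine (h.2 x hx y hy).map (H := H) (S' := D ∪ E) id (fun a b ha hb hab => ?_)
      fun _ h => Or.inl h
    rcases hab with hab | ⟨-, haS, hbS⟩
    · exact hab.connIn (Or.inl ha) (Or.inl hb)
    · obtain ⟨e, he, hae⟩ := hfull a haS
      obtain ⟨f, hf, hbf⟩ := hfull b hbS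
      exact ((hae.connIn (Or.inl ha) (Or.inr he)).trans (hED e he f hf)).trans
        (hbf.symm.connIn (Or.inr hf) (Or.inl hb))
  obtain ⟨s, hsD, hsS⟩ := hDS
  obtain ⟨e, he, hse⟩ := hfull s hsS
  have key : ∀ x ∈ D ∪ E, ConnIn H (D ∪ E) x e := by
    rintro x (hx | hx)
    · exact (hDD x hx s hsD).trans (hse.connIn (Or.inl hsD) (Or.inr he))
    · exact hED x hx e he
  exact ⟨⟨s, Or.inl hsD⟩, fun x hx y hy => (key x hx).trans (key y hy).symm⟩

/-- The bridge condition of `IsTight` persists when a decomposition of one part `A₁` is embedded,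
through `f`, into a decomposition glued at the node `t₀`. -/
theorem IsTight.full_of_glue {ι₁ : Type u} {H : SimpleGraph V} {A₁ A₂ S E : Set V}
    {T₁ : SimpleGraph ι₁} {B₁ : ι₁ → Set V} (h : IsTight (addClique H S) A₁ T₁ B₁)
    (hS : A₁ ∩ A₂ = S) (hE : IsConnSet H E) (hEA : E ⊆ A₂ \ S)
    (hEfull : ∀ s ∈ S, ∃ e ∈ E, H.Adj s e) {t₀ : ι₁} (ht₀ : S ⊆ B₁ t₀)
    {T : SimpleGraph ι} {B : ι → Set V} {f : ι₁ → ι} (hinj : Function.Injective f)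
    (hadj : ∀ a b, T.Adj (f a) (f b) → T₁.Adj a b)
    (hB : ∀ a, B (f a) = B₁ a) (hout : ∀ w ∉ Set.range f, B w ⊆ A₂)
    (hbd : ∀ a, ∀ w ∉ Set.range f, T.Adj (f a) w → a = t₀)
    {a b : ι₁} (hab : T₁.Adj a b) :
    ∃ X : Set ι, f a ∈ X ∧ f b ∉ X ∧
      (∀ u ∈ X, ∀ w ∉ X, T.Adj u w → u = f a ∧ w = f b) ∧
      ∃ D ⊆ (A₁ ∪ A₂) \ unionBags B Xᶜ, IsConnSet H D ∧
        ∀ v ∈ unionBags B X, v ∈ unionBags B Xᶜ → ∃ d ∈ D, H.Adj v d := by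
  obtain ⟨X, haX, hbX, hX, D, hDA, hD, hDfull⟩ := h.full a b hab
  by_cases ht : t₀ ∈ X
  · have hXc : unionBags B (Set.image f X ∪ (Set.range f)ᶜ)ᶜ ⊆ unionBags B₁ Xᶜ := by
      intro v hv
      obtain ⟨w, hw, hvw⟩ := mem_unionBags.1 hv
      simp only [Set.mem_compl_iff, Set.mem_union, not_or, not_not] at hw
      obtain ⟨hw1, c, rfl⟩ := hw
      exact mem_unionBags.2 ⟨c, fun hc => hw1 ⟨c, hc, rfl⟩, hB c ▸ hvw⟩
    have hXA : unionBags B₁ Xᶜ ⊆ A₁ := by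
      intro v hv
      obtain ⟨c, -, hvc⟩ := mem_unionBags.1 hv
      exact h.bag_sub c hvc
    have hfullX : ∀ v ∈ unionBags B (Set.image f X ∪ (Set.range f)ᶜ),
        v ∈ unionBags B (Set.image f X ∪ (Set.range f)ᶜ)ᶜ → ∃ d ∈ D, (addClique H S).Adj v d := by
      intro v hv hv'
      refine hDfull v ?_ (hXc hv')
      obtain ⟨w, hw | hw, hvw⟩ := mem_unionBags.1 hv
      · obtain ⟨c, hc, rfl⟩ := hw
        exact mem_unionBags.2 ⟨c, hc, hB c ▸ hvw⟩
      · exact mem_unionBags.2 ⟨t₀, ht, ht₀ (hS.subset ⟨hXA (hXc hv'), hout w hw hvw⟩)⟩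
    refine ⟨Set.image f X ∪ (Set.range f)ᶜ, Or.inl ⟨a, haX, rfl⟩, ?_, ?_, ?_⟩
    · rintro (⟨c, hc, hcb⟩ | hb)
      · exact hbX (hinj hcb ▸ hc)
      · exact hb ⟨b, rfl⟩
    · intro u hu w hw huw
      simp only [Set.mem_compl_iff, Set.mem_union, not_or, not_not] at hw
      obtain ⟨hw1, c, rfl⟩ := hw
      have hc : c ∉ X := fun hc => hw1 ⟨c, hc, rfl⟩
      rcases hu with ⟨d, hd, rfl⟩ | hu
      · obtain ⟨rfl, rfl⟩ := hX d hd c hc (hadj _ _ huw)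
        exact ⟨rfl, rfl⟩
      · exact absurd (hbd c u hu huw.symm ▸ ht) hc
    · by_cases hDS : Disjoint D S
      · refine ⟨D, fun d hd => ⟨Or.inl (hDA hd).1, fun h' => (hDA hd).2 (hXc h')⟩,
          hD.of_addClique hDS, fun v hv hv' => ?_⟩
        obtain ⟨d, hd, hvd⟩ := hfullX v hv hv'
        exact ⟨d, hd, hvd.resolve_right fun h => Set.disjoint_left.1 hDS hd h.2.2⟩
      · refine ⟨D ∪ E, ?_, hD.union_of_addClique hE (Set.not_disjoint_iff_nonempty_inter.1 hDS)
          hEfull, fun v hv hv' => ?_⟩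
        · rintro d (hd | hd)
          · exact ⟨Or.inl (hDA hd).1, fun h' => (hDA hd).2 (hXc h')⟩
          · exact ⟨Or.inr (hEA hd).1, fun h' => (hEA hd).2 (hS.subset ⟨hXA (hXc h'), (hEA hd).1⟩)⟩
        · obtain ⟨d, hd, hvd | ⟨-, hvS, -⟩⟩ := hfullX v hv hv'
          · exact ⟨d, Or.inl hd, hvd⟩
          · obtain ⟨e, he, hve⟩ := hEfull v hvS
            exact ⟨e, Or.inr he, hve⟩
  · have hSX : S ⊆ unionBags B₁ Xᶜ := fun s hs => mem_unionBags.2 ⟨t₀, ht, ht₀ hs⟩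
    have hDS : Disjoint D S := Set.disjoint_left.2 fun d hd hs => (hDA hd).2 (hSX hs)
    have hXc : ∀ v ∈ A₁, v ∈ unionBags B (Set.image f X)ᶜ → v ∈ unionBags B₁ Xᶜ := by
      intro v hvA hv
      obtain ⟨w, hw, hvw⟩ := mem_unionBags.1 hv
      by_cases hwf : w ∈ Set.range f
      · obtain ⟨c, rfl⟩ := hwf
        exact mem_unionBags.2 ⟨c, fun hc => hw ⟨c, hc, rfl⟩, hB c ▸ hvw⟩
      · exact hSX (hS.subset ⟨hvA, hout w hwf hvw⟩)
    refine ⟨Set.image f X, ⟨a, haX, rfl⟩, ?_, ?_, D, ?_, hD.of_addClique hDS, ?_⟩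
    · rintro ⟨c, hc, hcb⟩
      exact hbX (hinj hcb ▸ hc)
    · rintro _ ⟨c, hc, rfl⟩ w hw hcw
      by_cases hwf : w ∈ Set.range f
      · obtain ⟨d, rfl⟩ := hwf
        obtain ⟨rfl, rfl⟩ := hX c hc d (fun hd => hw ⟨d, hd, rfl⟩) (hadj _ _ hcw)
        exact ⟨rfl, rfl⟩
      · exact absurd (hbd c w hwf hcw ▸ hc) ht
    · exact fun d hd => ⟨Or.inl (hDA hd).1, fun h' => (hDA hd).2 (hXc d (hDA hd).1 h')⟩
    · intro v hv hv'
      obtain ⟨_, ⟨c, hc, rfl⟩, hvc⟩ := mem_unionBags.1 hv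
      rw [hB c] at hvc
      obtain ⟨d, hd, hvd⟩ := hDfull v (mem_unionBags.2 ⟨c, hc, hvc⟩)
        (hXc v (h.bag_sub c hvc) hv')
      exact ⟨d, hd, hvd.resolve_right fun h => Set.disjoint_left.1 hDS hd h.2.2⟩

/-- The disjoint union of two graphs together with one edge joining them. -/
def glueGraph {ι₁ ι₂ : Type u} (T₁ : SimpleGraph ι₁) (T₂ : SimpleGraph ι₂) (a : ι₁) (b : ι₂) :
    SimpleGraph (ι₁ ⊕ ι₂) where
  Adj
    | Sum.inl x, Sum.inl y => T₁.Adj x y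
    | Sum.inr x, Sum.inr y => T₂.Adj x y
    | Sum.inl x, Sum.inr y => x = a ∧ y = b
    | Sum.inr x, Sum.inl y => y = a ∧ x = b
  symm := ⟨by rintro (x | x) (y | y) h; exacts [h.symm, h, h, h.symm]⟩
  loopless := ⟨by rintro (x | x) h; exacts [T₁.loopless.1 x h, T₂.loopless.1 x h]⟩

theorem IsTight.glue {ι₁ ι₂ : Type u} {H : SimpleGraph V} {A S D D' : Set V}
    (hfp : FullPair H A S D D') {T₁ : SimpleGraph ι₁} {T₂ : SimpleGraph ι₂}
    {B₁ : ι₁ → Set V} {B₂ : ι₂ → Set V}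
    (h₁ : IsTight (addClique H S) (D ∪ S) T₁ B₁) (h₂ : IsTight (addClique H S) (A \ D) T₂ B₂) :
    ∃ T : SimpleGraph (ι₁ ⊕ ι₂), IsTight H A T (Sum.elim B₁ B₂) := by
  have hSD : S ⊆ A \ D := fun s hs =>
    ⟨hfp.sep_sub hs, fun h => Set.disjoint_left.1 hfp.left_disj h hs⟩
  have hinter : (D ∪ S) ∩ (A \ D) = S := by
    ext v
    constructor
    · rintro ⟨h | h, h'⟩
      exacts [absurd h h'.2, h]
    · exact fun h => ⟨Or.inr h, hSD h⟩
  have hunion : (D ∪ S) ∪ (A \ D) = A := by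
    ext v
    constructor
    · rintro ((h | h) | h)
      exacts [hfp.left_sub h, hfp.sep_sub h, h.1]
    · intro h
      by_cases hv : v ∈ D
      exacts [Or.inl (Or.inl hv), Or.inr ⟨h, hv⟩]
  have hclique : (addClique H S).IsClique S := fun x hx y hy hxy => Or.inr ⟨hxy, hx, hy⟩
  obtain ⟨a, ha⟩ := h₁.clique_sub S Set.subset_union_right hclique
  obtain ⟨b, hb⟩ := h₂.clique_sub S hSD hclique
  have hedge : (glueGraph T₁ T₂ a b).Adj (Sum.inl a) (Sum.inr b) := ⟨rfl, rfl⟩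
  have hl : ∀ {U : Set ι₁} {U' : Set (ι₁ ⊕ ι₂)} {x y}, (∀ z ∈ U, Sum.inl z ∈ U') →
      ConnIn T₁ U x y → ConnIn (glueGraph T₁ T₂ a b) U' (Sum.inl x) (Sum.inl y) :=
    fun hU h => h.map Sum.inl (fun x y hx hy hxy =>
      SimpleGraph.Adj.connIn (G := glueGraph T₁ T₂ a b) hxy (hU x hx) (hU y hy)) hU
  have hr : ∀ {U : Set ι₂} {U' : Set (ι₁ ⊕ ι₂)} {x y}, (∀ z ∈ U, Sum.inr z ∈ U') →
      ConnIn T₂ U x y → ConnIn (glueGraph T₁ T₂ a b) U' (Sum.inr x) (Sum.inr y) :=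
    fun hU h => h.map Sum.inr (fun x y hx hy hxy =>
      SimpleGraph.Adj.connIn (G := glueGraph T₁ T₂ a b) hxy (hU x hx) (hU y hy)) hU
  refine ⟨glueGraph T₁ T₂ a b, ?_, ?_, ?_, ?_, ?_⟩
  · have key : ∀ x, (glueGraph T₁ T₂ a b).Reachable x (Sum.inl a) := by
      rintro (x | x)
      · exact (hl (fun _ _ => Set.mem_univ _) (h₁.connected.connIn_univ x a)).reachable
      · exact (hr (fun _ _ => Set.mem_univ _) (h₂.connected.connIn_univ x b)).reachable.trans
          hedge.symm.reachable
    have : Nonempty (ι₁ ⊕ ι₂) := ⟨Sum.inl a⟩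
    exact ⟨fun x y => (key x).trans (key y).symm⟩
  · rintro (t | t)
    · exact (h₁.bag_sub t).trans (hunion ▸ Set.subset_union_left)
    · exact (h₂.bag_sub t).trans Set.sdiff_subset
  · intro Q hQA hQ
    have hQ' : (addClique H S).IsClique Q := hQ.mono (le_addClique H S)
    by_cases hQD : Disjoint Q D
    · obtain ⟨t, ht⟩ := h₂.clique_sub Q
        (fun q hq => ⟨hQA hq, Set.disjoint_left.1 hQD hq⟩) hQ'
      exact ⟨Sum.inr t, ht⟩
    · obtain ⟨d, hdQ, hdD⟩ := Set.not_disjoint_iff.1 hQD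
      obtain ⟨t, ht⟩ := h₁.clique_sub Q (fun q hq => by
        by_cases hqd : d = q
        · exact Or.inl (hqd ▸ hdD)
        · exact hfp.left_closed d hdD q (hQA hq) (hQ hdQ hq hqd)) hQ'
      exact ⟨Sum.inl t, ht⟩
  · have cross : ∀ v x y, v ∈ B₁ x → v ∈ B₂ y → ConnIn (glueGraph T₁ T₂ a b)
        {t | v ∈ Sum.elim B₁ B₂ t} (Sum.inl x) (Sum.inr y) := by
      intro v x y hx hy
      have hvS : v ∈ S := hinter.subset ⟨h₁.bag_sub x hx, h₂.bag_sub y hy⟩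
      exact ((hl (fun _ h => h) (h₁.link v x a hx (ha hvS))).trans
        (hedge.connIn (S := {t | v ∈ Sum.elim B₁ B₂ t}) (ha hvS) (hb hvS))).trans
        (hr (fun _ h => h) (h₂.link v b y (hb hvS) hy))
    rintro v (x | x) (y | y) hx hy
    · exact hl (fun _ h => h) (h₁.link v x y hx hy)
    · exact cross v x y hx hy
    · exact (cross v y x hy hx).symm
    · exact hr (fun _ h => h) (h₂.link v x y hx hy)
  · have hDsub : D ⊆ (D ∪ S) \ S :=
      fun d hd => ⟨Or.inl hd, Set.disjoint_left.1 hfp.left_disj hd⟩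
    have hD'sub : D' ⊆ (A \ D) \ S := fun d hd =>
      ⟨⟨hfp.right_sub hd, Set.disjoint_right.1 hfp.disj hd⟩,
        Set.disjoint_left.1 hfp.right_disj hd⟩
    have hinl : ∀ v, v ∈ unionBags (Sum.elim B₁ B₂) (Set.range Sum.inl) → v ∈ D ∪ S := by
      intro v hv
      obtain ⟨_, ⟨c, rfl⟩, hvc⟩ := mem_unionBags.1 hv
      exact h₁.bag_sub c hvc
    have hinr : ∀ v, v ∈ unionBags (Sum.elim B₁ B₂) (Set.range Sum.inr) → v ∈ A \ D := by
      intro v hv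
      obtain ⟨_, ⟨c, rfl⟩, hvc⟩ := mem_unionBags.1 hv
      exact h₂.bag_sub c hvc
    rintro (x | x) (y | y) hxy
    · have := h₁.full_of_glue hinter hfp.right_conn hD'sub hfp.right_full ha
        (T := glueGraph T₁ T₂ a b) (B := Sum.elim B₁ B₂) Sum.inl_injective
        (fun _ _ h => h) (fun _ => rfl)
        (by rintro (w | w) hw; exacts [absurd ⟨w, rfl⟩ hw, h₂.bag_sub w])
        (by rintro c (w | w) hw h; exacts [absurd ⟨w, rfl⟩ hw, h.1])
        (a := x) (b := y) hxy
      rwa [hunion] at this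
    · obtain ⟨rfl, rfl⟩ := hxy
      refine ⟨Set.range Sum.inl, ⟨_, rfl⟩, by simp, ?_, D, ?_, hfp.left_conn, ?_⟩
      · rintro _ ⟨c, rfl⟩ (w | w) hw h
        · exact absurd ⟨w, rfl⟩ hw
        · exact ⟨congrArg _ h.1, congrArg _ h.2⟩
      · rw [Set.compl_range_inl]
        exact fun d hd => ⟨hfp.left_sub hd, fun h => (hinr d h).2 hd⟩
      · rw [Set.compl_range_inl]
        exact fun v hv hv' => hfp.left_full v (hinter.subset ⟨hinl v hv, hinr v hv'⟩)
    · obtain ⟨rfl, rfl⟩ := hxy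
      refine ⟨Set.range Sum.inr, ⟨_, rfl⟩, by simp, ?_, D', ?_, hfp.right_conn, ?_⟩
      · rintro _ ⟨c, rfl⟩ (w | w) hw h
        · exact ⟨congrArg _ h.2, congrArg _ h.1⟩
        · exact absurd ⟨w, rfl⟩ hw
      · rw [Set.compl_range_inr]
        exact fun d hd => ⟨hfp.right_sub hd, fun h =>
          (hD'sub hd).2 (hinter.subset ⟨hinl d h, (hD'sub hd).1⟩)⟩
      · rw [Set.compl_range_inr]
        exact fun v hv hv' => hfp.right_full v (hinter.subset ⟨hinl v hv', hinr v hv⟩)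
    · have := h₂.full_of_glue (by rw [Set.inter_comm, hinter]) hfp.left_conn hDsub
        hfp.left_full hb
        (T := glueGraph T₁ T₂ a b) (B := Sum.elim B₁ B₂) Sum.inr_injective
        (fun _ _ h => h) (fun _ => rfl)
        (by rintro (w | w) hw; exacts [h₁.bag_sub w, absurd ⟨w, rfl⟩ hw])
        (by rintro c (w | w) hw h; exacts [h.2, absurd ⟨w, rfl⟩ hw])
        (a := x) (b := y) hxy
      rwa [Set.union_comm, hunion] at this

/-- The same tree and bags decompose the graph obtained by completing a part of a bag. -/
def TreeDecomp.addClique {H : SimpleGraph V} {T : SimpleGraph ι} (td : TreeDecomp H T)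
    {S : Set V} {t : ι} (hS : S ⊆ td.bag t) : TreeDecomp (addClique H S) T where
  isTree := td.isTree
  bag := td.bag
  exists_bag := td.exists_bag
  exists_bag_adj := by
    rintro u v (h | ⟨-, hu, hv⟩)
    exacts [td.exists_bag_adj h, ⟨t, hS hu, hS hv⟩]
  bag_sep := td.bag_sep

/-- Every tree-decomposition can be refined to a tight one of any connected vertex set. -/
theorem TreeDecomp.exists_isTight [Finite V] {T : SimpleGraph ι} {H : SimpleGraph V}
    (td : TreeDecomp H T) (A : Set V) :
    ∃ (κ : Type u) (T' : SimpleGraph κ) (B : κ → Set V), IsTight H A T' B ∧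
      ∀ t, ∃ s, B t ⊆ td.bag s := by
  induction hn : A.ncard using Nat.strong_induction_on generalizing A H with
  | _ n ih =>
    by_cases hA : ∃ t, A ⊆ td.bag t
    · obtain ⟨t, ht⟩ := hA
      exact ⟨PUnit, ⊥, fun _ => A, isTight_single H A, fun _ => ⟨t, ht⟩⟩
    push Not at hA
    obtain ⟨t, S, D, D', hSt, hfp⟩ := td.exists_fullPair hA
    obtain ⟨d, hd⟩ := hfp.left_conn.1
    obtain ⟨d', hd'⟩ := hfp.right_conn.1
    have hlt₁ : (D ∪ S).ncard < n := by
      rw [← hn]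
      refine Set.ncard_lt_ncard ⟨Set.union_subset hfp.left_sub hfp.sep_sub, fun h => ?_⟩
      rcases h (hfp.right_sub hd') with h | h
      exacts [Set.disjoint_left.1 hfp.disj h hd', Set.disjoint_left.1 hfp.right_disj hd' h]
    have hlt₂ : (A \ D).ncard < n := by
      rw [← hn]
      exact Set.ncard_lt_ncard ⟨Set.sdiff_subset, fun h => (h (hfp.left_sub hd)).2 hd⟩
    obtain ⟨κ₁, T₁, B₁, h₁, hB₁⟩ := ih _ hlt₁ (td.addClique hSt) _ rfl
    obtain ⟨κ₂, T₂, B₂, h₂, hB₂⟩ := ih _ hlt₂ (td.addClique hSt) _ rfl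
    obtain ⟨T', hT'⟩ := IsTight.glue hfp h₁ h₂
    refine ⟨κ₁ ⊕ κ₂, T', Sum.elim B₁ B₂, hT', ?_⟩
    rintro (t | t)
    exacts [hB₁ t, hB₂ t]

theorem IsTight.isTree {H : SimpleGraph V} {A : Set V} {T : SimpleGraph ι} {B : ι → Set V}
    (h : IsTight H A T B) : T.IsTree := by
  refine ⟨h.connected, isAcyclic_iff_forall_adj_isBridge.2 fun v w hvw => ?_⟩
  rw [isBridge_iff]
  rintro ⟨p⟩
  obtain ⟨X, hv, hw, hX, -⟩ := h.full v w hvw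
  have hp : ConnIn (T \ fromEdgeSet {s(v, w)}) Set.univ v w := ⟨p, fun _ _ => trivial⟩
  obtain ⟨a, b, ha, hb, -, hab, -⟩ := hp.exists_exit hv hw
  obtain ⟨rfl, rfl⟩ := hX a ha b hb hab.1
  exact hab.2 ⟨rfl, hvw.ne⟩

/-- A tight decomposition of all of `H` is a tree-decomposition. -/
def IsTight.treeDecomp {H : SimpleGraph V} {T : SimpleGraph ι} {B : ι → Set V}
    (h : IsTight H Set.univ T B) : TreeDecomp H T where
  isTree := h.isTree
  bag := B
  exists_bag v := by
    obtain ⟨t, ht⟩ := h.clique_sub {v} (Set.subset_univ _) (isClique_singleton v)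
    exact ⟨t, ht rfl⟩
  exists_bag_adj u v huv := by
    obtain ⟨t, ht⟩ := h.clique_sub {u, v} (Set.subset_univ _)
      (isClique_pair.2 fun _ => huv)
    exact ⟨t, ht (by simp), ht (by simp)⟩
  bag_sep t₁ t₃ p hp t₂ ht₂ v hv := by
    classical
    obtain ⟨q, hq⟩ := h.link v t₁ t₃ hv.1 hv.2
    have heq : p = q.bypass :=
      congrArg Subtype.val ((h.isTree.isAcyclic.subsingleton_path t₁ t₃).elim
        ⟨p, hp⟩ ⟨_, q.bypass_isPath⟩)
    exact hq t₂ (q.support_bypass_subset_support (heq ▸ ht₂))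

theorem mem_side_iff {T : SimpleGraph ι} {t₁ t₂ u : ι} :
    u ∈ Side T t₁ t₂ ↔ ConnIn T {t₂}ᶜ u t₁ := by
  classical
  constructor
  · rintro ⟨p, -, hp⟩
    exact ⟨p, fun v hv h => hp (h ▸ hv)⟩
  · rintro ⟨p, hp⟩
    exact ⟨p.bypass, p.bypass_isPath, fun h => hp _ (p.support_bypass_subset_support h) rfl⟩

theorem side_eq_of_cut {T : SimpleGraph ι} (hT : T.Connected) {t₁ t₂ : ι} {X : Set ι}
    (h₁ : t₁ ∈ X) (h₂ : t₂ ∉ X) (hX : ∀ u ∈ X, ∀ w ∉ X, T.Adj u w → u = t₁ ∧ w = t₂) :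
    Side T t₁ t₂ = X := by
  ext u
  rw [mem_side_iff]
  constructor
  · intro hu
    by_contra huX
    obtain ⟨a, b, ha, hb, -, hab, hua⟩ := hu.exists_exit (K := Xᶜ) huX (not_not.2 h₁)
    exact hua.right_mem.2 (hX b (not_not.1 hb) a ha hab.symm).2
  · intro hu
    obtain ⟨a, b, ha, hb, -, hab, hua⟩ := (hT.connIn_univ u t₂).exists_exit hu h₂
    obtain ⟨rfl, rfl⟩ := hX a ha b hb hab
    exact hua.mono fun v hv h => h₂ (h ▸ hv.1)

theorem IsTight.stable {H : SimpleGraph V} {T : SimpleGraph ι} {B : ι → Set V}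
    (h : IsTight H Set.univ T B) (hH : H.Connected) : h.treeDecomp.Stable := by
  intro t₁ t₂ hadj
  obtain ⟨X, h₁, h₂, hX, D, hDA, hD, hfull⟩ := h.full t₁ t₂ hadj
  rw [side_eq_of_cut h.connected h₁ h₂ hX]
  change IsConnSet H (unionBags B X)
  refine hH.isConnSet_univ.of_attached (Set.subset_univ _) (fun d hd => ?_) hD ?_
  · obtain ⟨t, ht⟩ := h.treeDecomp.exists_bag d
    by_cases htX : t ∈ X
    · exact mem_unionBags.2 ⟨t, htX, ht⟩
    · exact absurd (mem_unionBags.2 ⟨t, htX, ht⟩) (hDA hd).2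
  · intro s hs z _ hz hsz
    obtain ⟨t, hts, htz⟩ := h.treeDecomp.exists_bag_adj hsz
    exact hfull s hs (mem_unionBags.2 ⟨t, fun htX => hz (mem_unionBags.2 ⟨t, htX, htz⟩), hts⟩)

theorem exists_treeDecomp_treewidth {V : Type u} (G : SimpleGraph V) :
    ∃ (ι : Type u) (T : SimpleGraph ι) (td : TreeDecomp G T),
      ∀ t, (td.bag t).ncard ≤ treewidth G + 1 := by
  have hne : {k | ∃ (ι : Type u) (T : SimpleGraph ι) (td : TreeDecomp G T),
      ∀ t, (td.bag t).ncard ≤ k + 1}.Nonempty :=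
    ⟨(Set.univ : Set V).ncard, PUnit, ⊥, (isTight_single G Set.univ).treeDecomp,
      fun _ => Nat.le_succ _⟩
  exact Nat.sInf_mem hne

end

/-- every connected graph has a stable tree-decomposition of
width equal to its tree-width. -/
theorem exists_stable_optimal {V : Type u} [Finite V] (G : SimpleGraph V)
    (hG : G.Connected) :
    ∃ (ι : Type u) (T : SimpleGraph ι) (td : TreeDecomp G T),
      td.Stable ∧ ∀ t, (td.bag t).ncard ≤ treewidth G + 1 := by
  obtain ⟨ι, T, td, htd⟩ := exists_treeDecomp_treewidth G
  obtain ⟨κ, T', B, h, hB⟩ := td.exists_isTight Set.univ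
  refine ⟨κ, T', h.treeDecomp, h.stable hG, fun t => ?_⟩
  obtain ⟨s, hs⟩ := hB t
  exact (Set.ncard_le_ncard hs).trans (htd s)
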